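/- If A is a supersolvable essential central arrangement, then its Orlik–Terao ideal is generated in degree 2: I = I_2. More precisely, for every circuit C of A of cardinality ≥ 4, the element ∂(C) lies in the ideal generated by the elements ∂(D) over circuits D of cardinality 3. -/

import Mathlib

open MvPolynomial

/-- An essential central arrangement of hyperplanes in `K^n`, with hyperplanes indexed by `ι`:
the hyperplane `H i` is the kernel of the nonzero linear form with coefficient vector `form i`,
the forms are pairwise non-proportional (the hyperplanes are distinct), and they span the dual
space (the arrangement is essential, i.e. has rank `n`). -/
structure CentralArrangement (K : Type*) [Field K] (ι : Type*) [Fintype ι] (n : ℕ) where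
  form : ι → (Fin n → K)
  nonzero : ∀ i, form i ≠ 0
  nonProportional : ∀ i j, i ≠ j → ∀ t : K, form i ≠ t • form j
  essential : Submodule.span K (Set.range form) = ⊤

namespace CentralArrangement

variable {K : Type*} [Field K] {ι : Type*} [Fintype ι] {n : ℕ}

/-- The evaluation map `K^ι → K[x_1,…,x_n]_1 ≅ K^n`, sending `e i` to the form `α i`. -/
noncomputable def evalMap (A : CentralArrangement K ι n) : (ι → K) →ₗ[K] (Fin n → K) where
  toFun c := ∑ i, c i • A.form i
  map_add' x y := by
    simp [add_smul, Finset.sum_add_distrib]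
  map_smul' t x := by
    simp [smul_smul, Finset.smul_sum]

/-- The relation space `F(A)`: the kernel of the evaluation map. -/
noncomputable def relSpace (A : CentralArrangement K ι n) : Submodule K (ι → K) :=
  LinearMap.ker A.evalMap

end CentralArrangement

open Classical in
/-- The support of a vector `c : ι → K`, as a finset. -/
noncomputable def vsupp {K ι : Type*} [Field K] [Fintype ι] (c : ι → K) : Finset ι :=
  Finset.univ.filter fun j => c j ≠ 0

/-- The Orlik-Terao boundary `∂(c) = Σ_{j ∈ Λ} c_j · Π_{l ∈ Λ, l ≠ j} y_l`, where
`Λ` is the support of the dependency `c`. -/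
noncomputable def otgen {K ι : Type*} [Field K] [Fintype ι] [DecidableEq ι] (c : ι → K) :
    MvPolynomial ι K :=
  ∑ j ∈ vsupp c, MvPolynomial.C (c j) * ∏ l ∈ (vsupp c).erase j, MvPolynomial.X l

namespace CentralArrangement

variable {K : Type*} [Field K] {ι : Type*} [Fintype ι] [DecidableEq ι] {n : ℕ}

/-- The Orlik-Terao ideal `I`, generated by `∂(c)` for all relations `c ∈ F(A)`. -/
noncomputable def otIdeal (A : CentralArrangement K ι n) : Ideal (MvPolynomial ι K) :=
  Ideal.span (otgen '' (A.relSpace : Set (ι → K)))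

/-- The quadratic component `I₂` of the Orlik-Terao ideal: the ideal generated by the
degree-2 (homogeneous) elements of `I`. -/
noncomputable def otQuadratic (A : CentralArrangement K ι n) : Ideal (MvPolynomial ι K) :=
  Ideal.span {f | f ∈ A.otIdeal ∧ f.IsHomogeneous 2}

/-- A 3-relation is an element of `F(A)` with support of size 3; the arrangement is
2-formal if the 3-relations span the relation space. -/
def IsTwoFormal (A : CentralArrangement K ι n) : Prop :=
  Submodule.span K {c : ι → K | c ∈ A.relSpace ∧ (vsupp c).card = 3} = A.relSpace

end CentralArrangement

/-- A circuit of the arrangement: a minimal dependent subset of the defining forms. -/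
def CentralArrangement.IsCircuit {K : Type*} [Field K] {ι : Type*} [Fintype ι] {n : ℕ}
    (A : CentralArrangement K ι n) (S : Finset ι) : Prop :=
  (¬ LinearIndependent K fun i : S => A.form i) ∧
  ∀ T ⊂ S, LinearIndependent K fun i : T => A.form i

section RelativeBoundary

variable {K ι : Type*} [Field K] [DecidableEq ι]

/-- The Orlik-Terao boundary of a vector `c`, formed relative to a finset `T` of variables
instead of the support of `c`. -/
noncomputable def otgenOn (T : Finset ι) (c : ι → K) : MvPolynomial ι K :=
  ∑ j ∈ T, C (c j) * ∏ l ∈ T.erase j, X l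

lemma otgenOn_add (T : Finset ι) (a b : ι → K) :
    otgenOn T (a + b) = otgenOn T a + otgenOn T b := by
  simp [otgenOn, add_mul, Finset.sum_add_distrib]

lemma otgenOn_smul (T : Finset ι) (t : K) (a : ι → K) :
    otgenOn T (t • a) = C t * otgenOn T a := by
  simp [otgenOn, Finset.mul_sum, mul_assoc]

lemma otgenOn_insert {a : ι} {T : Finset ι} (ha : a ∉ T) (c : ι → K) :
    otgenOn (insert a T) c = C (c a) * ∏ l ∈ T, X l + X a * otgenOn T c := by
  unfold otgenOn
  rw [Finset.sum_insert ha, Finset.erase_insert ha, Finset.mul_sum]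
  congr 1
  refine Finset.sum_congr rfl fun j hj => ?_
  have hja : a ≠ j := fun h => ha (h ▸ hj)
  rw [Finset.erase_insert_of_ne hja,
    Finset.prod_insert fun h => ha (Finset.mem_of_mem_erase h)]
  ring

/-- Eliminating `r` and `s` in turn from a vector `c` by means of a vector `t` supported on
`{r, s, u}` recovers the boundary of `c`. -/
lemma otgenOn_elimination {r s u : ι} {B : Finset ι} (hrs : r ≠ s) (hru : r ≠ u) (hsu : s ≠ u)
    (hr : r ∉ B) (hs : s ∉ B) (hu : u ∉ B) (c t : ι → K) (ht : ∀ i ∈ B, t i = 0)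
    (hcu : c u = 0) :
    C (t u) * otgenOn (insert r (insert s B)) c =
      otgenOn B c * otgenOn {r, s, u} t -
        otgenOn (insert s (insert u B)) (t r • c + (-c r) • t) -
        otgenOn (insert r (insert u B)) (t s • c + (-c s) • t) := by
  have htB : otgenOn B t = 0 :=
    Finset.sum_eq_zero fun j hj => by simp [ht j hj]
  have hu0 : otgenOn {u} t = C (t u) := by simp [otgenOn]
  simp only [otgenOn_add, otgenOn_smul]
  rw [otgenOn_insert (a := r) (T := insert s B) (by simp [hrs, hr]),
    otgenOn_insert hs,
    otgenOn_insert (a := r) (T := {s, u}) (by simp [hrs, hru]),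
    otgenOn_insert (a := s) (T := {u}) (by simp [hsu]), hu0,
    otgenOn_insert (a := s) (T := insert u B) (by simp [hsu, hs]),
    otgenOn_insert (a := s) (T := insert u B) (by simp [hsu, hs]),
    otgenOn_insert (a := r) (T := insert u B) (by simp [hru, hr]),
    otgenOn_insert (a := r) (T := insert u B) (by simp [hru, hr]),
    otgenOn_insert hu, otgenOn_insert hu, htB, hcu,
    Finset.prod_insert hs, Finset.prod_insert hu, Finset.prod_pair hsu]
  simp only [Finset.prod_singleton, map_neg, map_zero]
  ring

end RelativeBoundary

section Support

variable {K ι : Type*} [Field K] [Fintype ι]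

lemma mem_vsupp {c : ι → K} {i : ι} : i ∈ vsupp c ↔ c i ≠ 0 := by
  simp [vsupp]

lemma vsupp_subset_iff {c : ι → K} {T : Finset ι} : vsupp c ⊆ T ↔ ∀ i ∉ T, c i = 0 := by
  simp only [Finset.subset_iff, mem_vsupp]
  exact forall_congr' fun i => not_imp_comm

variable [DecidableEq ι]

lemma otgenOn_vsupp (c : ι → K) : otgenOn (vsupp c) c = otgen c := rfl

lemma otgenOn_eq_prod_mul {T : Finset ι} {c : ι → K} (h : vsupp c ⊆ T) :
    otgenOn T c = (∏ l ∈ T \ vsupp c, X l) * otgen c := by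
  unfold otgenOn otgen
  rw [Finset.mul_sum, ← Finset.sum_subset h]
  · refine Finset.sum_congr rfl fun j hj => ?_
    have hT : T.erase j = (T \ vsupp c) ∪ (vsupp c).erase j := by
      ext i
      have := @h i
      simp only [Finset.mem_erase, Finset.mem_union, Finset.mem_sdiff]
      grind
    have hd : Disjoint (T \ vsupp c) ((vsupp c).erase j) :=
      Finset.sdiff_disjoint.mono_right (Finset.erase_subset _ _)
    rw [hT, Finset.prod_union hd]
    ring
  · intro j _ hj
    have : c j = 0 := by simpa [mem_vsupp] using hj
    simp [this]

lemma otgenOn_mem {J : Ideal (MvPolynomial ι K)} {T : Finset ι} {c : ι → K}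
    (h : vsupp c ⊆ T) (hc : otgen c ∈ J) : otgenOn T c ∈ J := by
  rw [otgenOn_eq_prod_mul h]
  exact J.mul_mem_left _ hc

lemma otgen_isHomogeneous (c : ι → K) : (otgen c).IsHomogeneous ((vsupp c).card - 1) := by
  refine IsHomogeneous.sum _ _ _ fun j hj => ?_
  have h := (isHomogeneous_C ι (c j)).mul
    (IsHomogeneous.prod ((vsupp c).erase j) (fun l => (X l : MvPolynomial ι K)) (fun _ => 1)
      fun l _ => isHomogeneous_X K l)
  simpa [Finset.card_erase_of_mem hj] using h

end Support

namespace CentralArrangement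

variable {K : Type*} [Field K] {ι : Type*} [Fintype ι] {n : ℕ} (A : CentralArrangement K ι n)

lemma mem_relSpace {c : ι → K} : c ∈ A.relSpace ↔ ∑ i, c i • A.form i = 0 := Iff.rfl

lemma sum_eq_zero_of_mem_relSpace {c : ι → K} (hc : c ∈ A.relSpace) {T : Finset ι}
    (h : vsupp c ⊆ T) : ∑ i ∈ T, c i • A.form i = 0 := by
  rw [← A.mem_relSpace.1 hc]
  refine Finset.sum_subset (Finset.subset_univ _) fun i _ hi => ?_
  simp [vsupp_subset_iff.1 h i hi]

lemma not_linearIndependent_iff {T : Finset ι} :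
    (¬ LinearIndependent K fun i : T => A.form i) ↔
      ∃ c ∈ A.relSpace, c ≠ 0 ∧ vsupp c ⊆ T := by
  classical
  change ¬ LinearIndepOn K A.form (T : Set ι) ↔ _
  rw [linearIndepOn_finset_iff]
  push Not
  constructor
  · rintro ⟨f, hf, i, hi, hfi⟩
    have hsub : vsupp (fun j => if j ∈ T then f j else 0) ⊆ T :=
      vsupp_subset_iff.2 fun j hj => by simp [hj]
    refine ⟨_, ?_, fun h => hfi ?_, hsub⟩
    · rw [mem_relSpace, ← hf, ← Finset.sum_subset (Finset.subset_univ T)]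
      · exact Finset.sum_congr rfl fun j hj => by simp [hj]
      · intro j _ hj
        simp [hj]
    · simpa [hi] using congrFun h i
  · rintro ⟨c, hc, hc0, hsub⟩
    obtain ⟨i, hi⟩ := Function.ne_iff.1 hc0
    exact ⟨c, A.sum_eq_zero_of_mem_relSpace hc hsub, i, hsub (mem_vsupp.2 hi), hi⟩

lemma exists_vsupp_eq_of_isCircuit {S : Finset ι} (hS : A.IsCircuit S) :
    ∃ c ∈ A.relSpace, vsupp c = S := by
  obtain ⟨c, hc, hc0, hsub⟩ := A.not_linearIndependent_iff.1 hS.1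
  refine ⟨c, hc, by_contra fun hne => ?_⟩
  exact A.not_linearIndependent_iff.2 ⟨c, hc, hc0, subset_rfl⟩
    (hS.2 _ (hsub.ssubset_of_ne hne))

lemma exists_vsupp_ssubset_of_not_isCircuit {c : ι → K} (hc : c ∈ A.relSpace) (hc0 : c ≠ 0)
    (hS : ¬ A.IsCircuit (vsupp c)) :
    ∃ e ∈ A.relSpace, e ≠ 0 ∧ vsupp e ⊂ vsupp c := by
  have hdep := A.not_linearIndependent_iff.2 ⟨c, hc, hc0, subset_rfl⟩
  simp only [IsCircuit, not_and, not_forall] at hS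
  obtain ⟨T, hT, hTdep⟩ := hS hdep
  obtain ⟨e, he, he0, hsub⟩ := A.not_linearIndependent_iff.1 hTdep
  exact ⟨e, he, he0, hsub.trans_ssubset hT⟩

lemma three_le_card_vsupp {c : ι → K} (hc : c ∈ A.relSpace) (hc0 : c ≠ 0) :
    3 ≤ (vsupp c).card := by
  classical
  have hsum := A.sum_eq_zero_of_mem_relSpace hc subset_rfl
  by_contra! hlt
  obtain h | h | h : (vsupp c).card = 0 ∨ (vsupp c).card = 1 ∨ (vsupp c).card = 2 := by lia
  · rw [Finset.card_eq_zero] at h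
    refine hc0 (funext fun i => by_contra fun hi => ?_)
    simpa [h] using mem_vsupp.2 hi
  · obtain ⟨a, ha⟩ := Finset.card_eq_one.1 h
    have hca : c a ≠ 0 := mem_vsupp.1 (by simp [ha])
    rw [ha, Finset.sum_singleton] at hsum
    exact (smul_ne_zero hca (A.nonzero a)) hsum
  · obtain ⟨a, b, hab, hS⟩ := Finset.card_eq_two.1 h
    have hca : c a ≠ 0 := mem_vsupp.1 (by simp [hS])
    rw [hS, Finset.sum_pair hab] at hsum
    refine A.nonProportional a b hab (-((c a)⁻¹ * c b)) ?_
    rw [neg_smul, mul_smul, ← smul_neg, ← eq_neg_of_add_eq_zero_left hsum, inv_smul_smul₀ hca]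

/-- If the nonzero relation `e` has support strictly inside that of `c`, then the boundary of `c`
is controlled by boundaries of relations with strictly smaller support. -/
lemma otgen_mem_of_vsupp_ssubset [DecidableEq ι] {J : Ideal (MvPolynomial ι K)} {c e : ι → K}
    (hc : c ∈ A.relSpace) (he : e ∈ A.relSpace) (he0 : e ≠ 0) (hsub : vsupp e ⊂ vsupp c)
    (ih : ∀ b ∈ A.relSpace, vsupp b ⊂ vsupp c → otgen b ∈ J) : otgen c ∈ J := by
  obtain ⟨i, hi⟩ := Function.ne_iff.1 he0
  have hic : i ∈ vsupp c := hsub.subset (mem_vsupp.2 hi)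
  set b := c + (-(c i / e i)) • e with hb
  have hbrel : b ∈ A.relSpace := add_mem hc (Submodule.smul_mem _ _ he)
  have hbsub : vsupp b ⊆ vsupp c := vsupp_subset_iff.2 fun j hj => by
    have h1 := vsupp_subset_iff.1 subset_rfl j hj
    have h2 := vsupp_subset_iff.1 hsub.subset j hj
    simp [hb, h1, h2]
  have hbi : i ∉ vsupp b := by
    rw [mem_vsupp, not_not]
    have : e i ≠ 0 := hi
    simp [hb, this]
  have hbss : vsupp b ⊂ vsupp c := Finset.ssubset_iff_subset_ne.2 ⟨hbsub, fun h => hbi (h ▸ hic)⟩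
  have hceq : c = b + (c i / e i) • e := by simp [hb]
  have hsplit : otgen c = otgenOn (vsupp c) b + C (c i / e i) * otgenOn (vsupp c) e := by
    rw [← otgenOn_smul, ← otgenOn_add, ← hceq, otgenOn_vsupp]
  rw [hsplit]
  exact add_mem (otgenOn_mem hbsub (ih b hbrel hbss))
    (J.mul_mem_left _ (otgenOn_mem hsub.subset (ih e he hsub)))

lemma otgen_mem_span_of_forall_isCircuit {d : ℕ} (A : CentralArrangement K (Fin d) n)
    (hss : ∀ S : Finset (Fin d), A.IsCircuit S → 4 ≤ S.card →
      ∃ r ∈ S, ∃ s ∈ S, ∃ u : Fin d, r < s ∧ s < u ∧ A.IsCircuit {r, s, u})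
    (c : Fin d → K) (hc : c ∈ A.relSpace) :
    otgen c ∈ Ideal.span {g : MvPolynomial (Fin d) K |
      ∃ c' : Fin d → K, c' ∈ A.relSpace ∧ A.IsCircuit (vsupp c') ∧
        (vsupp c').card = 3 ∧ g = otgen c'} := by
  set J := Ideal.span {g : MvPolynomial (Fin d) K |
      ∃ c' : Fin d → K, c' ∈ A.relSpace ∧ A.IsCircuit (vsupp c') ∧
        (vsupp c').card = 3 ∧ g = otgen c'} with hJ
  let w : Finset (Fin d) → ℕ := fun T => ∑ i ∈ T, (d - i)
  have w_mono {S T : Finset (Fin d)} (h : S ⊆ T) : w S ≤ w T := Finset.sum_le_sum_of_subset h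
  have w_insert {a : Fin d} {T : Finset (Fin d)} (h : a ∉ T) : w (insert a T) = d - a + w T :=
    Finset.sum_insert h
  induction hw : w (vsupp c) using Nat.strong_induction_on generalizing c with
  | _ m ih =>
  subst hw
  replace ih : ∀ b ∈ A.relSpace, w (vsupp b) < w (vsupp c) → otgen b ∈ J :=
    fun b hb hlt => ih _ hlt b hb rfl
  obtain rfl | hc0 := eq_or_ne c 0
  · simp [otgen, vsupp]
  by_cases hcirc : A.IsCircuit (vsupp c)
  swap
  · obtain ⟨e, he, he0, hsub⟩ := A.exists_vsupp_ssubset_of_not_isCircuit hc hc0 hcirc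
    refine A.otgen_mem_of_vsupp_ssubset hc he he0 hsub fun b hb hlt => ih b hb ?_
    obtain ⟨i, hi, hib⟩ := Finset.exists_of_ssubset hlt
    have h1 := w_mono (Finset.insert_subset hi hlt.subset)
    have h2 := w_insert hib
    have h3 := i.isLt
    lia
  obtain h3 | h4 := (A.three_le_card_vsupp hc hc0).eq_or_lt
  · exact Ideal.subset_span ⟨c, hc, hcirc, h3.symm, rfl⟩
  obtain ⟨r, hr, s, hs, u, hrs, hsu, hcirc3⟩ := hss _ hcirc h4
  obtain ⟨t, ht, htS⟩ := A.exists_vsupp_eq_of_isCircuit hcirc3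
  have hcard3 : ({r, s, u} : Finset (Fin d)).card = 3 :=
    Finset.card_eq_three.2 ⟨r, s, u, hrs.ne, (hrs.trans hsu).ne, hsu.ne, rfl⟩
  have hu : u ∉ vsupp c := fun hu => by
    have hsub : ({r, s, u} : Finset (Fin d)) ⊆ vsupp c := by
      simp [Finset.insert_subset_iff, hr, hs, hu]
    refine hcirc3.1 (hcirc.2 _ (hsub.ssubset_of_ne fun h => ?_))
    rw [h] at hcard3
    lia
  have htu : t u ≠ 0 := mem_vsupp.1 (by simp [htS])
  have htJ : otgenOn {r, s, u} t ∈ J := by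
    rw [← htS, otgenOn_vsupp]
    exact Ideal.subset_span ⟨t, ht, htS ▸ hcirc3, htS ▸ hcard3, rfl⟩
  set B := ((vsupp c).erase r).erase s with hB
  have hrB : r ∉ B := by simp [hB]
  have hsB : s ∉ B := by simp [hB]
  have huB : u ∉ B := fun h => hu (Finset.mem_of_mem_erase (Finset.mem_of_mem_erase h))
  have hru := hrs.trans hsu
  have hcB : vsupp c = insert r (insert s B) := by
    rw [hB, Finset.insert_erase (Finset.mem_erase.2 ⟨hrs.ne', hs⟩), Finset.insert_erase hr]
  have hc_zero : ∀ i, i ≠ r → i ≠ s → i ∉ B → c i = 0 := fun i h1 h2 h3 =>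
    vsupp_subset_iff.1 hcB.subset i (by simp [h1, h2, h3])
  have ht_zero : ∀ i, i ≠ r → i ≠ s → i ≠ u → t i = 0 := fun i h1 h2 h3 =>
    vsupp_subset_iff.1 htS.subset i (by simp [h1, h2, h3])
  have htB : ∀ i ∈ B, t i = 0 := fun i hi =>
    ht_zero i (ne_of_mem_of_not_mem hi hrB) (ne_of_mem_of_not_mem hi hsB)
      (ne_of_mem_of_not_mem hi huB)
  have helim (a b : Fin d) (hab : a ≠ b) (hau : a < u) (hbu : b ≠ u) (haB : a ∉ B) (hbB : b ∉ B)
      (hcab : vsupp c = insert a (insert b B))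
      (hz : ∀ i, i ≠ a → i ≠ b → i ≠ u → t i = 0) :
      otgenOn (insert b (insert u B)) (t a • c + (-c a) • t) ∈ J := by
    have hsub : vsupp (t a • c + (-c a) • t) ⊆ insert b (insert u B) := by
      refine vsupp_subset_iff.2 fun i hi => ?_
      simp only [Finset.mem_insert, not_or] at hi
      obtain rfl | hia := eq_or_ne i a
      · simp [mul_comm]
      · have h1 : c i = 0 := vsupp_subset_iff.1 hcab.subset i (by simp [hia, hi.1, hi.2.2])
        simp [h1, hz i hia hi.1 hi.2.1]
    refine otgenOn_mem hsub (ih _ (add_mem (Submodule.smul_mem _ _ hc)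
      (Submodule.smul_mem _ _ ht)) ((w_mono hsub).trans_lt ?_))
    rw [hcab, w_insert (by simp [hbu, hbB]), w_insert huB, w_insert (by simp [hab, haB]),
      w_insert hbB]
    have := u.isLt
    lia
  have hmem : C (t u) * otgen c ∈ J := by
    rw [← otgenOn_vsupp, hcB, otgenOn_elimination hrs.ne hru.ne hsu.ne hrB hsB huB c t htB
      (by simpa [mem_vsupp] using hu)]
    exact sub_mem (sub_mem (J.mul_mem_left _ htJ)
      (helim r s hrs.ne hru hsu.ne hrB hsB hcB ht_zero))
      (helim s r hrs.ne' hsu hru.ne hsB hrB (hcB.trans (Finset.insert_comm _ _ _))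
        fun i h1 h2 => ht_zero i h2 h1)
  have hinv : otgen c = C (t u)⁻¹ * (C (t u) * otgen c) := by
    rw [← mul_assoc, ← C_mul, inv_mul_cancel₀ htu, C_1, one_mul]
  rw [hinv]
  exact J.mul_mem_left _ hmem

end CentralArrangement

/-- If `A` is a supersolvable essential central arrangement — here encoded by
the resulting combinatorial property of a suitable ordering of the hyperplanes: for every
circuit `{H_{j_1},…,H_{j_p}}` with `j_1 < ⋯ < j_p` and `p ≥ 4` there are `r < s` in the
circuit and `u > s` with `{H_r, H_s, H_u}` a circuit — then its Orlik-Terao ideal is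
generated in degree 2: `I = I₂`.  More precisely, for every relation `c` supported on a
circuit of cardinality `≥ 4`, the element `∂(c)` lies in the ideal generated by the `∂(c')`
over relations `c'` supported on circuits of cardinality 3. -/
theorem supersolvable_otIdeal_eq_quadratic
    (K : Type*) [Field K] (d n : ℕ)
    (A : CentralArrangement K (Fin d) n)
    (hss : ∀ S : Finset (Fin d), A.IsCircuit S → 4 ≤ S.card →
      ∃ r ∈ S, ∃ s ∈ S, ∃ u : Fin d, r < s ∧ s < u ∧ A.IsCircuit {r, s, u}) :
    A.otIdeal = A.otQuadratic ∧
    ∀ c : Fin d → K, c ∈ A.relSpace → A.IsCircuit (vsupp c) → 4 ≤ (vsupp c).card →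
      otgen c ∈ Ideal.span {g : MvPolynomial (Fin d) K |
        ∃ c' : Fin d → K, c' ∈ A.relSpace ∧ A.IsCircuit (vsupp c') ∧
          (vsupp c').card = 3 ∧ g = otgen c'} := by
  have key := A.otgen_mem_span_of_forall_isCircuit hss
  refine ⟨le_antisymm ?_ (Ideal.span_le.2 fun f hf => hf.1), fun c hc _ _ => key c hc⟩
  refine Ideal.span_le.2 ?_
  rintro _ ⟨c, hc, rfl⟩
  refine Ideal.span_mono ?_ (key c hc)
  rintro _ ⟨c', hc', _, h3, rfl⟩
  exact ⟨Ideal.subset_span ⟨c', hc', rfl⟩, by simpa [h3] using otgen_isHomogeneous c'⟩
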